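/- Let b ≥ 2, let S ∈ Σ_b^∞ be Borel normal in base b, and let T = S[0]S[0…1]S[0…2]… be the sequence obtained by concatenating every prefix of S in order of increasing length. Then T is Borel normal in base b. -/

import Mathlib

/-- Number of sliding-block occurrences of `w` in `s`:
`N(w,s) = |{i : s[i…i+|w|−1] = w}|`. -/
def slideN {α : Type*} [DecidableEq α] (w s : List α) : ℕ :=
  ((Finset.range (s.length + 1 - w.length)).filter
    (fun i => ((s.drop i).take w.length) = w)).card

/-- Sliding count probability of `w` in `s`: `P(w,s) = N(w,s)/(|s|−|w|+1)`. -/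
noncomputable def slideP {α : Type*} [DecidableEq α] (w s : List α) : ℝ :=
  (slideN w s : ℝ) / ((s.length : ℝ) - (w.length : ℝ) + 1)

/-- `l`-th sliding block entropy of a string, with logarithms base `|α|`.
The convention `0 · log(1/0) = 0` holds automatically since `Real.logb b 0⁻¹ = 0`. -/
noncomputable def slideH {α : Type*} [Fintype α] [DecidableEq α] (l : ℕ) (x : List α) : ℝ :=
  (1 / (l : ℝ)) * ∑ w : Fin l → α,
    slideP (List.ofFn w) x * Real.logb (Fintype.card α) (slideP (List.ofFn w) x)⁻¹

/-- The prefix `S[0…n]` of a sequence, i.e. its first `n+1` symbols. -/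
def pre {α : Type*} (S : ℕ → α) (n : ℕ) : List α := List.ofFn (fun i : Fin (n + 1) => S i)

/-- Finite-state dimension via sliding block entropies:
`dim_FS(S) = inf_{l ≥ 1} liminf_{n→∞} H_l(S[0…n])`. -/
noncomputable def dimFS {α : Type*} [Fintype α] [DecidableEq α] (S : ℕ → α) : ℝ :=
  ⨅ l : ℕ, Filter.liminf (fun n => slideH (l + 1) (pre S n)) Filter.atTop

/-- Finite-state strong dimension:
`Dim_FS(S) = inf_{l ≥ 1} limsup_{n→∞} H_l(S[0…n])`. -/
noncomputable def DimFS {α : Type*} [Fintype α] [DecidableEq α] (S : ℕ → α) : ℝ :=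
  ⨅ l : ℕ, Filter.limsup (fun n => slideH (l + 1) (pre S n)) Filter.atTop
/-- Cumulative lengths of a sequence of lists. -/
def cumLen {α : Type*} (L : ℕ → List α) : ℕ → ℕ
  | 0 => 0
  | m + 1 => cumLen L m + (L m).length

open scoped Classical in
/-- The infinite sequence obtained by concatenating the lists `L 0, L 1, L 2, …`
(a default symbol is used in the degenerate case where the total length is finite). -/
noncomputable def concatSeq {α : Type*} (dflt : α) (L : ℕ → List α) (k : ℕ) : α :=
  if h : ∃ m, k < cumLen L (m + 1) then
    (L (Nat.find h)).getD (k - cumLen L (Nat.find h)) dflt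
  else dflt
/-- A sequence `S ∈ Σ_b^∞` is Borel normal in base `b` if every nonempty string
`w` occurs with limiting sliding-block frequency `b^{-|w|}`. -/
def BorelNormal {b : ℕ} (S : ℕ → Fin b) : Prop :=
  ∀ w : List (Fin b), w ≠ [] →
    Filter.Tendsto (fun n => (slideN w (pre S n) : ℝ) / (n : ℝ)) Filter.atTop
      (nhds (((b : ℝ) ^ w.length)⁻¹))

open Filter Topology

/-- `u n / n → p` iff `u n - p * n` is bounded by `ε * n` up to a constant, for every `ε > 0`. -/
theorem tendsto_div_natCast_iff (u : ℕ → ℝ) (p : ℝ) :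
    Tendsto (fun n : ℕ => u n / (n : ℝ)) atTop (𝓝 p) ↔
      ∀ ε > 0, ∃ K : ℝ, ∀ n : ℕ, |u n - p * n| ≤ ε * n + K := by
  constructor
  · intro h ε hε
    obtain ⟨N, hN⟩ := Metric.tendsto_atTop.1 h ε hε
    refine ⟨∑ i ∈ Finset.range (N + 1), |u i - p * i|, fun n => ?_⟩
    have hsum : 0 ≤ ∑ i ∈ Finset.range (N + 1), |u i - p * i| :=
      Finset.sum_nonneg fun _ _ => abs_nonneg _
    rcases lt_or_ge n (N + 1) with hn | hn
    · have := Finset.single_le_sum (f := fun i : ℕ => |u i - p * i|)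
        (fun _ _ => abs_nonneg _) (Finset.mem_range.2 hn)
      have : 0 ≤ ε * n := by positivity
      linarith
    · have hpos : (0 : ℝ) < n := by exact_mod_cast (by omega : 0 < n)
      have h1 := hN n (by omega)
      rw [Real.dist_eq] at h1
      have h2 : u n - p * n = (u n / n - p) * n := by field_simp
      rw [h2, abs_mul, abs_of_pos hpos]
      nlinarith
  · intro h
    refine Metric.tendsto_atTop.2 fun ε hε => ?_
    obtain ⟨K, hK⟩ := h (ε / 2) (by positivity)
    obtain ⟨N, hN⟩ := exists_nat_gt (K / (ε / 2))
    refine ⟨N + 1, fun n hn => ?_⟩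
    have hpos : (0 : ℝ) < n := by exact_mod_cast (by omega : 0 < n)
    have hNn : (N : ℝ) ≤ n := by exact_mod_cast (by omega : N ≤ n)
    rw [div_lt_iff₀ (by positivity)] at hN
    have h2 : u n / n - p = (u n - p * n) / n := by field_simp
    rw [Real.dist_eq, h2, abs_div, abs_of_pos hpos, div_lt_iff₀ hpos]
    have := hK n
    nlinarith

theorem getElem_pre {α : Type*} (S : ℕ → α) {n i : ℕ} (h : i < (pre S n).length) : (pre S n)[i] = S i := by
  rw [List.getElem_of_eq (pre.eq_1 S n), List.getElem_ofFn]

section Occurrences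

variable {α : Type*} [DecidableEq α]

/-- The string `w` occurs in the sequence `S` at position `i`. -/
def OccursAt (w : List α) (S : ℕ → α) (i : ℕ) : Prop :=
  (List.range w.length).map (fun j => S (i + j)) = w

instance (w : List α) (S : ℕ → α) : DecidablePred (OccursAt w S) :=
  fun _ => inferInstanceAs (Decidable (_ = _))

theorem slideN_pre (w : List α) (S : ℕ → α) (n : ℕ) :
    slideN w (pre S n) = Nat.count (OccursAt w S) (n + 2 - w.length) := by
  have hlen : (pre S n).length = n + 1 := by simp [pre]
  rw [slideN, Nat.count_eq_card_filter_range, hlen]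
  congr 1
  refine Finset.filter_congr fun i hi => ?_
  rw [Finset.mem_range] at hi
  have : ((pre S n).drop i).take w.length = (List.range w.length).map (fun j => S (i + j)) := by
    apply List.ext_getElem
    · simp [hlen]; omega
    · intro j h1 h2
      simp [getElem_pre]
  rw [this, OccursAt]

theorem abs_count_sub_count_le (P : ℕ → Prop) [DecidablePred P] {m n : ℕ} (h : m ≤ n) :
    |(Nat.count P n : ℝ) - Nat.count P m| ≤ (n : ℝ) - m := by
  obtain ⟨d, rfl⟩ := Nat.exists_eq_add_of_le h
  have h1 := Nat.count_le (p := fun k => P (m + k)) (n := d)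
  rw [Nat.count_add]
  push_cast
  rw [add_sub_cancel_left, add_sub_cancel_left, abs_of_nonneg (by positivity)]
  exact_mod_cast h1

theorem abs_slideN_pre_sub_count_le (w : List α) (S : ℕ → α) (n : ℕ) :
    |(slideN w (pre S n) : ℝ) - Nat.count (OccursAt w S) n| ≤ w.length + 2 := by
  rw [slideN_pre]
  rcases le_total n (n + 2 - w.length) with h | h
  · refine (abs_count_sub_count_le _ h).trans ?_
    have : ((n + 2 - w.length : ℕ) : ℝ) ≤ n + 2 := by exact_mod_cast Nat.sub_le _ _
    have : (0 : ℝ) ≤ w.length := by positivity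
    linarith
  · rw [abs_sub_comm]
    refine (abs_count_sub_count_le _ h).trans ?_
    have : (n : ℝ) + 2 ≤ (n + 2 - w.length : ℕ) + w.length := by
      exact_mod_cast (by omega : n + 2 ≤ (n + 2 - w.length) + w.length)
    linarith

theorem tendsto_slideN_iff (w : List α) (S : ℕ → α) (p : ℝ) :
    Tendsto (fun n => (slideN w (pre S n) : ℝ) / (n : ℝ)) atTop (𝓝 p) ↔
      ∀ ε > 0, ∃ K : ℝ, ∀ n : ℕ, |(Nat.count (OccursAt w S) n : ℝ) - p * n| ≤ ε * n + K := by
  rw [tendsto_div_natCast_iff]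
  refine forall₂_congr fun ε _ => ⟨?_, ?_⟩
  all_goals
    rintro ⟨K, hK⟩
    refine ⟨K + (w.length + 2), fun n => ?_⟩
    have h1 := abs_le.1 (hK n)
    have h2 := abs_le.1 (abs_slideN_pre_sub_count_le w S n)
    rw [abs_le]
    constructor <;> linarith

/-- Sequences agreeing on their first `M` symbols have nearly the same occurrence counts. -/
theorem abs_count_occursAt_sub_le (w : List α) {A B : ℕ → α} {M r : ℕ}
    (hAB : ∀ j < M, A j = B j) (hr : r ≤ M) :
    |(Nat.count (OccursAt w A) r : ℝ) - Nat.count (OccursAt w B) r| ≤ w.length := by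
  have hle : r - w.length ≤ r := Nat.sub_le _ _
  have heq : Nat.count (OccursAt w A) (r - w.length) =
      Nat.count (OccursAt w B) (r - w.length) := by
    rw [Nat.count_eq_card_filter_range, Nat.count_eq_card_filter_range]
    congr 1
    refine Finset.filter_congr fun i hi => ?_
    rw [Finset.mem_range] at hi
    have : (List.range w.length).map (fun j => A (i + j)) =
        (List.range w.length).map (fun j => B (i + j)) := by
      refine List.map_congr_left fun j hj => hAB _ ?_
      rw [List.mem_range] at hj
      omega
    rw [OccursAt, OccursAt, this]
  have h1 := Nat.count_monotone (OccursAt w A) hle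
  have h2 := Nat.count_monotone (OccursAt w B) hle
  have h3 := abs_le.1 (abs_count_sub_count_le (OccursAt w A) hle)
  have h4 := abs_le.1 (abs_count_sub_count_le (OccursAt w B) hle)
  have h5 : (r : ℝ) ≤ (r - w.length : ℕ) + w.length := by
    exact_mod_cast (by omega : r ≤ (r - w.length) + w.length)
  rw [heq] at h1 h3
  have h1' : (Nat.count (OccursAt w B) (r - w.length) : ℝ) ≤ Nat.count (OccursAt w A) r := by
    exact_mod_cast h1
  have h2' : (Nat.count (OccursAt w B) (r - w.length) : ℝ) ≤ Nat.count (OccursAt w B) r := by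
    exact_mod_cast h2
  rw [abs_le]
  constructor <;> linarith

end Occurrences

section Concatenation

variable {α : Type*}

theorem cumLen_mono (L : ℕ → List α) : Monotone (cumLen L) :=
  monotone_nat_of_le_succ fun m => by rw [cumLen]; omega

theorem concatSeq_cumLen_add (d : α) (L : ℕ → List α) {m j : ℕ} (hj : j < (L m).length) :
    concatSeq d L (cumLen L m + j) = (L m).getD j d := by
  classical
  have hm : cumLen L m + j < cumLen L (m + 1) := by rw [cumLen]; omega
  have hex : ∃ m', cumLen L m + j < cumLen L (m' + 1) := ⟨m, hm⟩
  have hfind : Nat.find hex = m := by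
    rw [Nat.find_eq_iff]
    refine ⟨hm, fun i hi => ?_⟩
    have := cumLen_mono L (by omega : i + 1 ≤ m)
    omega
  rw [concatSeq, dif_pos hex]
  simp [hfind]

theorem concatSeq_pre (d : α) (S : ℕ → α) {m j : ℕ} (hj : j < m + 1) :
    concatSeq d (fun i => pre S i) (cumLen (fun i => pre S i) m + j) = S j := by
  have hlen : j < (pre S m).length := by simpa [pre] using hj
  rw [concatSeq_cumLen_add d _ hlen, List.getD_eq_getElem _ _ hlen, getElem_pre]

theorem cumLen_pre_succ (S : ℕ → α) (m : ℕ) :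
    cumLen (fun i => pre S i) (m + 1) = cumLen (fun i => pre S i) m + (m + 1) := by
  simp [cumLen, pre]

theorem two_mul_cumLen_pre (S : ℕ → α) (m : ℕ) :
    2 * cumLen (fun i => pre S i) m = m * (m + 1) := by
  induction m with
  | zero => simp [cumLen]
  | succ m ih => rw [cumLen_pre_succ, mul_add, ih]; ring

theorem exists_cumLen_pre_add (S : ℕ → α) (n : ℕ) :
    ∃ m r, r ≤ m + 1 ∧ n = cumLen (fun i => pre S i) m + r := by
  induction n with
  | zero => exact ⟨0, 0, by omega, by simp [cumLen]⟩
  | succ n ih =>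
    obtain ⟨m, r, hr, rfl⟩ := ih
    rcases hr.lt_or_eq with h | h
    · exact ⟨m, r + 1, by omega, by omega⟩
    · exact ⟨m + 1, 1, by omega, by rw [cumLen_pre_succ]; omega⟩

theorem abs_count_concatSeq_pre_block_le [DecidableEq α] (d : α) (S : ℕ → α) (w : List α)
    {m r : ℕ} (hr : r ≤ m + 1) :
    |(Nat.count (OccursAt w (concatSeq d fun i => pre S i))
        (cumLen (fun i => pre S i) m + r) : ℝ)
      - Nat.count (OccursAt w (concatSeq d fun i => pre S i)) (cumLen (fun i => pre S i) m)
      - Nat.count (OccursAt w S) r| ≤ w.length := by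
  have h := abs_count_occursAt_sub_le w
    (A := fun j => concatSeq d (fun i => pre S i) (cumLen (fun i => pre S i) m + j))
    (fun j hj => concatSeq_pre d S hj) hr
  rw [Nat.count_add]
  push_cast
  rw [add_sub_cancel_left]
  convert h using 6
  · rfl
  · simp only [OccursAt, Nat.add_assoc]

theorem abs_count_concatSeq_pre_cumLen_le [DecidableEq α] (d : α) (S : ℕ → α) (w : List α)
    {p ε K : ℝ}
    (hK : ∀ n : ℕ, |(Nat.count (OccursAt w S) n : ℝ) - p * n| ≤ ε * n + K) (m : ℕ) :
    |(Nat.count (OccursAt w (concatSeq d fun i => pre S i)) (cumLen (fun i => pre S i) m) : ℝ)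
      - p * cumLen (fun i => pre S i) m|
        ≤ ε * cumLen (fun i => pre S i) m + m * (K + w.length) := by
  induction m with
  | zero => simp [cumLen]
  | succ m ih =>
    have h1 := abs_le.1 (abs_count_concatSeq_pre_block_le d S w (le_refl (m + 1)))
    have h2 := abs_le.1 (hK (m + 1))
    have h3 := abs_le.1 ih
    rw [cumLen_pre_succ]
    push_cast at *
    rw [abs_le]
    constructor <;> linarith

theorem tendsto_slideN_concatSeq_pre [DecidableEq α] (d : α) (S : ℕ → α) (w : List α) {p : ℝ}
    (h : Tendsto (fun n => (slideN w (pre S n) : ℝ) / (n : ℝ)) atTop (𝓝 p)) :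
    Tendsto (fun n => (slideN w (pre (concatSeq d fun i => pre S i) n) : ℝ) / (n : ℝ))
      atTop (𝓝 p) := by
  rw [tendsto_slideN_iff] at h ⊢
  intro ε hε
  obtain ⟨K, hK⟩ := h (ε / 2) (by positivity)
  set c : ℝ := K + w.length with hc
  refine ⟨c + c ^ 2 / ε, fun n => ?_⟩
  obtain ⟨m, r, hr, rfl⟩ := exists_cumLen_pre_add S n
  have h1 := abs_le.1 (abs_count_concatSeq_pre_block_le d S w hr)
  have h2 := abs_le.1 (hK r)
  have h3 := abs_le.1 (abs_count_concatSeq_pre_cumLen_le d S w hK m)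
  have h4 : 2 * (cumLen (fun i => pre S i) m : ℝ) = m * (m + 1) := by
    exact_mod_cast two_mul_cumLen_pre S m
  have h5 : m * c ≤ ε / 2 * cumLen (fun i => pre S i) m + c ^ 2 / ε := by
    have hsq : m * c ≤ ε / 4 * (m : ℝ) ^ 2 + c ^ 2 / ε := by
      have h6 : ε / 4 * (m : ℝ) ^ 2 + c ^ 2 / ε - m * c = (ε * m / 2 - c) ^ 2 / ε := by
        field_simp
        ring
      have : 0 ≤ (ε * m / 2 - c) ^ 2 / ε := by positivity
      linarith
    have : 0 ≤ ε * m := by positivity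
    nlinarith
  have h7 : 0 ≤ ε * r := by positivity
  push_cast
  rw [abs_le]
  constructor <;> linarith

end Concatenation

/-- If `S ∈ Σ_b^∞` is Borel normal in base `b ≥ 2`, then the sequence
`T = S[0]S[0…1]S[0…2]…` obtained by concatenating every prefix of `S` in order of
increasing length is Borel normal in base `b`. -/
theorem stmt6 (b : ℕ) (hb : 2 ≤ b) (S : ℕ → Fin b) (hS : BorelNormal S) :
    BorelNormal (concatSeq (⟨0, by omega⟩ : Fin b) (fun i => pre S i)) :=
  fun w hw => tendsto_slideN_concatSeq_pre _ S w (hS w hw)
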